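/- Let K_n be compact connected subsets of a compact set in ℝ² converging to a compact connected set K in the Hausdorff distance. Then SM¹(K) ≤ liminf_{n→∞} SM¹(K_n), i.e., the outer Minkowski content is lower semicontinuous with respect to Hausdorff convergence on continua. -/

import Mathlib

open Metric MeasureTheory Set Filter Topology ENNReal

noncomputable abbrev Plane := EuclideanSpace ℝ (Fin 2)

/-- The outer Minkowski content `SM¹(K) = lim_{ε→0⁺} L(K^ε \ K)/ε`
(the limit exists in `[0,∞]` for continua, so it coincides with the `limsup`). -/
noncomputable def SM1 (K : Set Plane) : ℝ≥0∞ :=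
  limsup (fun ε : ℝ => volume (cthickening ε K \ K) / ENNReal.ofReal ε) (𝓝[>] (0 : ℝ))

set_option linter.unusedSimpArgs false

def fcS (K : Set (ℝ × ℝ)) : Set (ℤ × ℤ) :=
  {q | ∃ p ∈ K, (q.1 : ℝ) - 1 ≤ p.1 ∧ p.1 ≤ q.1 ∧ (q.2 : ℝ) - 1 ≤ p.2 ∧ p.2 ≤ q.2}
def heS (K : Set (ℝ × ℝ)) : Set (ℤ × ℤ) :=
  {q | ∃ p ∈ K, (q.1 : ℝ) - 1 ≤ p.1 ∧ p.1 ≤ q.1 ∧ p.2 = q.2}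
def veS (K : Set (ℝ × ℝ)) : Set (ℤ × ℤ) :=
  {q | ∃ p ∈ K, p.1 = q.1 ∧ (q.2 : ℝ) - 1 ≤ p.2 ∧ p.2 ≤ q.2}
def vtS (K : Set (ℝ × ℝ)) : Set (ℤ × ℤ) :=
  {q | ∃ p ∈ K, p.1 = q.1 ∧ p.2 = q.2}

lemma fcS_finite {K : Set (ℝ × ℝ)} (hK : IsCompact K) : (fcS K).Finite := by
  obtain ⟨R, hR⟩ := hK.isBounded.subset_closedBall (0 : ℝ × ℝ)
  obtain ⟨N, hN⟩ := exists_nat_ge R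
  refine ((Set.finite_Icc (-(N:ℤ)) (N+1)).prod (Set.finite_Icc (-(N:ℤ)) (N+1))).subset ?_
  rintro ⟨i, j⟩ ⟨p, hp, h1, h2, h3, h4⟩
  have := hR hp
  rw [mem_closedBall, dist_zero_right, Prod.norm_def, max_le_iff, Real.norm_eq_abs,
    Real.norm_eq_abs, abs_le, abs_le] at this
  simp only [mem_prod, mem_Icc] at *
  refine ⟨⟨?_, ?_⟩, ?_, ?_⟩ <;> (have : True := trivial) <;> (rify; linarith)

lemma grid_reach_removed {K : Set (ℝ × ℝ)} (hf : (fcS K).Finite)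
    (G : SimpleGraph (fcS K))
    (hv : ∀ a b : fcS K, b.1 = (a.1.1 + 1, a.1.2) → a.1 ∈ veS K → G.Reachable a b)
    (hh : ∀ a b : fcS K, b.1 = (a.1.1, a.1.2 + 1) → a.1 ∈ heS K → (a.1.1 - 1, a.1.2) ∉ vtS K →
      G.Reachable a b) :
    ∀ a b : fcS K, b.1 = (a.1.1, a.1.2 + 1) → a.1 ∈ heS K → G.Reachable a b := by
  obtain ⟨L, hL⟩ := (hf.image Prod.fst).bddBelow
  have hL' : ∀ a : fcS K, L ≤ a.1.1 := fun a => hL ⟨a.1, a.2, rfl⟩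
  have key : ∀ n : ℕ, ∀ a b : fcS K, a.1.1 ≤ L + n → b.1 = (a.1.1, a.1.2 + 1) → a.1 ∈ heS K →
      G.Reachable a b := by
    intro n
    induction n with
    | zero =>
      intro a b ha hb hae
      refine hh a b hb hae ?_
      rintro ⟨p, hp, h1, h2⟩
      have hm : ((a.1.1 - 1, a.1.2) : ℤ × ℤ) ∈ fcS K := ⟨p, hp, by simp [h1, h2], by simp [h1, h2], by simp [h1, h2], by simp [h1, h2]⟩
      have := hL' ⟨_, hm⟩
      simp at this ha
      linarith
    | succ n ih =>
      intro a b ha hb hae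
      by_cases hq : (a.1.1 - 1, a.1.2) ∈ vtS K
      · obtain ⟨p, hp, h1, h2⟩ := hq
        have hm : ((a.1.1 - 1, a.1.2) : ℤ × ℤ) ∈ fcS K :=
          ⟨p, hp, by simp [h1, h2], by simp [h1, h2], by simp [h1, h2], by simp [h1, h2]⟩
        have hm' : ((a.1.1 - 1, a.1.2 + 1) : ℤ × ℤ) ∈ fcS K :=
          ⟨p, hp, by simp [h1, h2], by simp [h1, h2], by simp [h1, h2], by simp [h1, h2]⟩
        have r1 : G.Reachable ⟨_, hm⟩ a := hv _ _ (by simp) ⟨p, hp, h1, by simp [h1, h2], by simp [h1, h2]⟩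
        have r2 : G.Reachable ⟨_, hm'⟩ b := hv _ _ (by simp [hb]) ⟨p, hp, h1, by simp [h1, h2], by simp [h1, h2]⟩
        have r3 : G.Reachable ⟨_, hm⟩ ⟨_, hm'⟩ := by
          refine ih _ _ ?_ rfl ⟨p, hp, by simp [h1, h2], by simp [h1, h2], by simp [h1, h2]⟩
          push_cast at ha
          simp only
          linarith
        exact r1.symm.trans (r3.trans r2)
      · exact hh a b hb hae hq
  intro a b
  exact key (a.1.1 - L).toNat a b (by have := hL' a; omega)

lemma grid_connected {K : Set (ℝ × ℝ)} (hK : IsCompact K) (hc : IsConnected K)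
    (G : SimpleGraph (fcS K))
    (hv : ∀ a b : fcS K, b.1 = (a.1.1 + 1, a.1.2) → a.1 ∈ veS K → G.Reachable a b)
    (hh : ∀ a b : fcS K, b.1 = (a.1.1, a.1.2 + 1) → a.1 ∈ heS K → G.Reachable a b) :
    G.Connected := by
  let cell : ℤ × ℤ → Set (ℝ × ℝ) := fun q =>
    Icc ((q.1 : ℝ) - 1) q.1 ×ˢ Icc ((q.2 : ℝ) - 1) q.2
  have cellcl : ∀ q, IsClosed (cell q) := fun q => isClosed_Icc.prod isClosed_Icc
  have memfc : ∀ p ∈ K, ∀ q, p ∈ cell q → q ∈ fcS K := by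
    rintro p hp q ⟨⟨h1, h2⟩, h3, h4⟩
    exact ⟨p, hp, h1, h2, h3, h4⟩
  have hfin : Finite (fcS K) := (fcS_finite hK)
  have cover : ∀ p ∈ K, ∃ q : fcS K, p ∈ cell q.1 := by
    intro p hp
    have : p ∈ cell (⌈p.1⌉, ⌈p.2⌉) :=
      ⟨⟨by linarith [Int.ceil_lt_add_one p.1], Int.le_ceil _⟩,
        by linarith [Int.ceil_lt_add_one p.2], Int.le_ceil _⟩
    exact ⟨⟨_, memfc p hp _ this⟩, this⟩
  -- horizontal moves
  have mv1 : ∀ p ∈ K, ∀ a b : fcS K, p ∈ cell a.1 → p ∈ cell b.1 → a.1.2 = b.1.2 →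
      a.1.1 ≤ b.1.1 → G.Reachable a b := by
    rintro p hp ⟨⟨i, j⟩, ha⟩ ⟨⟨i', j'⟩, hb⟩ ⟨⟨h1, h2⟩, h3, h4⟩ ⟨⟨h5, h6⟩, h7, h8⟩ e1 e2
    simp only at *
    subst e1
    rcases e2.eq_or_lt with h | h
    · subst h; exact SimpleGraph.Reachable.refl _
    · have h' : i + 1 ≤ i' := h
      have h'' : i' ≤ i + 1 := by
        have : (i' : ℝ) ≤ i + 1 := by linarith
        exact_mod_cast this
      have e : i' = i + 1 := le_antisymm h'' h'
      subst e
      push_cast at *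
      exact hv _ _ rfl ⟨p, hp, by simp only; linarith, h3, h4⟩
  have mv2 : ∀ p ∈ K, ∀ a b : fcS K, p ∈ cell a.1 → p ∈ cell b.1 → a.1.1 = b.1.1 →
      a.1.2 ≤ b.1.2 → G.Reachable a b := by
    rintro p hp ⟨⟨i, j⟩, ha⟩ ⟨⟨i', j'⟩, hb⟩ ⟨⟨h1, h2⟩, h3, h4⟩ ⟨⟨h5, h6⟩, h7, h8⟩ e1 e2
    simp only at *
    subst e1
    rcases e2.eq_or_lt with h | h
    · subst h; exact SimpleGraph.Reachable.refl _
    · have h' : j + 1 ≤ j' := h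
      have h'' : j' ≤ j + 1 := by
        have : (j' : ℝ) ≤ j + 1 := by linarith
        exact_mod_cast this
      have e : j' = j + 1 := le_antisymm h'' h'
      subst e
      push_cast at *
      exact hh _ _ rfl ⟨p, hp, h1, h2, by simp only; linarith⟩
  have mv : ∀ p ∈ K, ∀ a b : fcS K, p ∈ cell a.1 → p ∈ cell b.1 → G.Reachable a b := by
    intro p hp a b ha hb
    have hm : p ∈ cell (b.1.1, a.1.2) := ⟨hb.1, ha.2⟩
    let c : fcS K := ⟨_, memfc p hp _ hm⟩
    have r1 : G.Reachable a c := by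
      rcases le_total a.1.1 b.1.1 with h | h
      · exact mv1 p hp a c ha hm rfl h
      · exact (mv1 p hp c a hm ha rfl h).symm
    have r2 : G.Reachable c b := by
      rcases le_total a.1.2 b.1.2 with h | h
      · exact mv2 p hp c b hm hb rfl h
      · exact (mv2 p hp b c hb hm rfl h).symm
    exact r1.trans r2
  have hne : Nonempty (fcS K) := by
    obtain ⟨p, hp⟩ := hc.nonempty
    exact ⟨(cover p hp).choose⟩
  refine ⟨?_⟩
  intro a b
  by_contra hab
  let A : Set (ℝ × ℝ) := ⋃ c ∈ {c : fcS K | G.Reachable a c}, cell c.1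
  let B : Set (ℝ × ℝ) := ⋃ c ∈ {c : fcS K | ¬ G.Reachable a c}, cell c.1
  have hA : IsClosed A := (Set.toFinite _).isClosed_biUnion fun c _ => cellcl c.1
  have hB : IsClosed B := (Set.toFinite _).isClosed_biUnion fun c _ => cellcl c.1
  have hpt : ∀ c : fcS K, ∃ p ∈ K, p ∈ cell c.1 := by
    rintro ⟨q, p, hp, h1, h2, h3, h4⟩
    exact ⟨p, hp, ⟨h1, h2⟩, h3, h4⟩
  obtain ⟨p, hp, hpA, hpB⟩ := isPreconnected_closed_iff.1 hc.isPreconnected A B hA hB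
    (by
      intro p hp
      obtain ⟨q, hq⟩ := cover p hp
      by_cases h : G.Reachable a q
      · exact Or.inl (mem_biUnion (show q ∈ {c : fcS K | G.Reachable a c} from h) hq)
      · exact Or.inr (mem_biUnion (show q ∈ {c : fcS K | ¬ G.Reachable a c} from h) hq))
    (by
      obtain ⟨p, hp, hpa⟩ := hpt a
      exact ⟨p, hp, mem_biUnion (show a ∈ {c : fcS K | G.Reachable a c} from .refl _) hpa⟩)
    (by
      obtain ⟨p, hp, hpa⟩ := hpt b
      exact ⟨p, hp, mem_biUnion (show b ∈ {c : fcS K | ¬ G.Reachable a c} from hab) hpa⟩)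
  simp only [A, B, mem_iUnion, mem_ofPred_eq] at hpA hpB
  obtain ⟨c, hc1, hc2⟩ := hpA
  obtain ⟨d, hd1, hd2⟩ := hpB
  exact hd1 (hc1.trans (mv p hp c d hc2 hd2))

lemma grid_count {K : Set (ℝ × ℝ)} (hK : IsCompact K) (hc : IsConnected K) :
    (fcS K).encard + (vtS K).encard ≤ (heS K).encard + (veS K).encard + 1 := by
  have hf := fcS_finite hK
  have hhe : heS K ⊆ fcS K := by
    rintro q ⟨p, hp, h1, h2, h3⟩; exact ⟨p, hp, h1, h2, by linarith, by linarith⟩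
  have hve : veS K ⊆ fcS K := by
    rintro q ⟨p, hp, h1, h2, h3⟩; exact ⟨p, hp, by linarith, by linarith, h2, h3⟩
  have hvt : vtS K ⊆ fcS K := by
    rintro q ⟨p, hp, h1, h2⟩; exact ⟨p, hp, by linarith, by linarith, by linarith, by linarith⟩
  have fhe := hf.subset hhe
  have fve := hf.subset hve
  have fvt := hf.subset hvt
  let sh : ℤ × ℤ → ℤ × ℤ := fun q => (q.1 + 1, q.2)
  have shinj : Function.Injective sh := by
    rintro ⟨a, b⟩ ⟨c, d⟩ h; simpa [sh] using h
  have hsh : sh '' vtS K ⊆ heS K := by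
    rintro _ ⟨q, ⟨p, hp, h1, h2⟩, rfl⟩
    exact ⟨p, hp, by simp [sh, h1], by simp [sh, h1], by simp [sh, h2]⟩
  let R : fcS K → fcS K → Prop := fun a b =>
    (b.1 = (a.1.1, a.1.2 + 1) ∧ a.1 ∈ heS K ∧ (a.1.1 - 1, a.1.2) ∉ vtS K) ∨
    (b.1 = (a.1.1 + 1, a.1.2) ∧ a.1 ∈ veS K)
  let G : SimpleGraph (fcS K) := SimpleGraph.fromRel R
  have adj : ∀ a b, R a b → G.Reachable a b := by
    intro a b h
    refine SimpleGraph.Adj.reachable ?_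
    refine (SimpleGraph.fromRel_adj _ _ _).2 ⟨?_, Or.inl h⟩
    rintro rfl
    rcases h with h | h
    · have := congrArg Prod.snd h.1; simp at this
    · have := congrArg Prod.fst h.1; simp at this
  have hconn : G.Connected := by
    have hv : ∀ a b : fcS K, b.1 = (a.1.1 + 1, a.1.2) → a.1 ∈ veS K → G.Reachable a b :=
      fun a b h1 h2 => adj a b (Or.inr ⟨h1, h2⟩)
    exact grid_connected hK hc G hv (grid_reach_removed hf G hv
      (fun a b h1 h2 h3 => adj a b (Or.inl ⟨h1, h2, h3⟩)))
  have h1 := hconn.card_vert_le_card_edgeSet_add_one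
  let f1 : ℤ × ℤ → Sym2 (ℤ × ℤ) := fun a => s(a, (a.1, a.2 + 1))
  let f2 : ℤ × ℤ → Sym2 (ℤ × ℤ) := fun a => s(a, (a.1 + 1, a.2))
  have hsub : Sym2.map Subtype.val '' G.edgeSet ⊆
      f1 '' (heS K \ sh '' vtS K) ∪ f2 '' veS K := by
    rintro _ ⟨e, he, rfl⟩
    induction e using Sym2.ind with
    | _ a b =>
    have key : ∀ a b : fcS K, R a b → s(a.1, b.1) ∈ f1 '' (heS K \ sh '' vtS K) ∪ f2 '' veS K := by
      rintro a b (⟨h1, h2, h3⟩ | ⟨h1, h2⟩)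
      · refine Or.inl ⟨a.1, ⟨h2, ?_⟩, by simp [f1, h1]⟩
        rintro ⟨q, hq, hqa⟩
        apply h3
        rw [← hqa]
        simpa [sh] using hq
      · exact Or.inr ⟨a.1, h2, by simp [f2, h1]⟩
    rw [SimpleGraph.mem_edgeSet, SimpleGraph.fromRel_adj] at he
    rw [Sym2.map_mk]
    rcases he.2 with h | h
    · exact key a b h
    · rw [Sym2.eq_swap]; exact key b a h
  have h2 : Nat.card G.edgeSet ≤ (heS K \ sh '' vtS K).ncard + (veS K).ncard := by
    have e1 : Nat.card G.edgeSet = (Sym2.map Subtype.val '' G.edgeSet).ncard := by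
      rw [Set.ncard_image_of_injective _ (Sym2.map.injective Subtype.val_injective)]
      rfl
    rw [e1]
    have ff : (heS K \ sh '' vtS K).Finite := fhe.subset sdiff_subset
    calc _ ≤ _ := Set.ncard_le_ncard hsub ((ff.image _).union (fve.image _))
      _ ≤ _ := Set.ncard_union_le _ _
      _ ≤ _ := add_le_add (Set.ncard_image_le ff) (Set.ncard_image_le fve)
  have h3 : (heS K \ sh '' vtS K).ncard + (vtS K).ncard = (heS K).ncard := by
    rw [← Set.ncard_image_of_injective (vtS K) shinj]
    exact Set.ncard_sdiff_add_ncard_of_subset hsh fhe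
  have h4 : Nat.card (fcS K) = (fcS K).ncard := rfl
  rw [← hf.cast_ncard_eq, ← fhe.cast_ncard_eq, ← fve.cast_ncard_eq, ← fvt.cast_ncard_eq]
  norm_cast
  omega

open scoped Pointwise

noncomputable def segP (u : Plane) : Set Plane := (fun t : ℝ => t • u) '' Icc 0 1

lemma segP_compact (u : Plane) : IsCompact (segP u) :=
  isCompact_Icc.image (by fun_prop)

lemma segP_connected (u : Plane) : IsConnected (segP u) :=
  (isConnected_Icc zero_le_one).image _ (by fun_prop)

lemma conn_add {A B : Set Plane} (hA : IsConnected A) (hB : IsConnected B) :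
    IsConnected (A + B) := by
  rw [← Set.add_image_prod]
  exact (hA.prod hB).image _ (by fun_prop)

noncomputable def cntP (b : Module.Basis (Fin 2) ℝ Plane) (A : Set Plane) (y : Plane) : ℝ≥0∞ :=
  ∑' q : ℤ × ℤ, A.indicator 1 (y + ((q.1 : ℝ) • b 0 + (q.2 : ℝ) • b 1))

lemma cntP_eq (b : Module.Basis (Fin 2) ℝ Plane) (A : Set Plane) (y : Plane) :
    cntP b A y = ({q : ℤ × ℤ | y + ((q.1 : ℝ) • b 0 + (q.2 : ℝ) • b 1) ∈ A}.encard : ℝ≥0∞) := by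
  rw [← ENNReal.tsum_set_one, cntP, tsum_subtype _ (fun _ => (1 : ℝ≥0∞))]
  refine tsum_congr fun q => ?_
  simp only [Set.indicator, mem_ofPred_eq, Pi.one_apply]

lemma cntP_measurable (b : Module.Basis (Fin 2) ℝ Plane) {A : Set Plane} (hA : MeasurableSet A) :
    Measurable (cntP b A) := by
  unfold cntP
  refine Measurable.tsum fun q => ?_
  exact (measurable_one.indicator hA).comp (by fun_prop)

lemma vol_eq_cntP (b : Module.Basis (Fin 2) ℝ Plane) {A : Set Plane} (hA : MeasurableSet A) :
    volume A = ∫⁻ y in ZSpan.fundamentalDomain b, cntP b A y := by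
  have hD := ZSpan.isAddFundamentalDomain b (volume : Measure Plane)
  have : VAddInvariantMeasure (Submodule.span ℤ (Set.range b)) Plane volume :=
    ⟨fun g s _ => measure_preimage_add volume (g : Plane) s⟩
  let e : (ℤ × ℤ) ≃ Submodule.span ℤ (Set.range b) :=
    (finTwoArrowEquiv ℤ).symm.trans (b.restrictScalars ℤ).equivFun.symm.toEquiv
  have he : ∀ q, ((e q : Submodule.span ℤ (Set.range b)) : Plane) =
      (q.1 : ℝ) • b 0 + (q.2 : ℝ) • b 1 := by
    intro q
    simp [e, Module.Basis.equivFun_symm_apply, Fin.sum_univ_two, Int.cast_smul_eq_zsmul]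
  rw [← lintegral_indicator_one hA, hD.lintegral_eq_tsum'', ← e.tsum_eq]
  unfold cntP
  rw [lintegral_tsum]
  · refine tsum_congr fun q => ?_
    refine lintegral_congr fun y => ?_
    rw [← he, add_comm]
    rfl
  · intro q
    exact ((measurable_one.indicator hA).comp (by fun_prop)).aemeasurable

lemma second_diff_basis (b : Module.Basis (Fin 2) ℝ Plane) {K : Set Plane} (hK : IsCompact K)
    (hc : IsConnected K) :
    volume (K + segP (b 0) + segP (b 1)) + volume K ≤
      volume (K + segP (b 0)) + volume (K + segP (b 1)) +
        volume (ZSpan.fundamentalDomain b) := by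
  have m0 := hK.measurableSet
  have m1 := (hK.add (segP_compact (b 0))).measurableSet
  have m2 := (hK.add (segP_compact (b 1))).measurableSet
  have m3 := ((hK.add (segP_compact (b 0))).add (segP_compact (b 1))).measurableSet
  rw [vol_eq_cntP b m0, vol_eq_cntP b m1, vol_eq_cntP b m2, vol_eq_cntP b m3,
    ← lintegral_add_left (cntP_measurable b m3), ← lintegral_add_left (cntP_measurable b m1)]
  have : volume (ZSpan.fundamentalDomain b) = ∫⁻ y in ZSpan.fundamentalDomain b, 1 := by simp
  rw [this, ← lintegral_add_right _ measurable_const]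
  refine lintegral_mono fun y => ?_
  let φ : Plane → ℝ × ℝ := fun k => (b.repr (k - y) 0, b.repr (k - y) 1)
  have hφ : Continuous φ := by
    have h : ∀ i, Continuous fun k : Plane => b.repr (k - y) i := by
      intro i
      have := (LinearMap.continuous_of_finiteDimensional (b.coord i))
      exact this.comp (continuous_id.sub continuous_const)
    exact (h 0).prodMk (h 1)
  have hrec : ∀ k, k = y + ((φ k).1 • b 0 + (φ k).2 • b 1) := by
    intro k
    have := b.sum_repr (k - y)
    rw [Fin.sum_univ_two] at this
    simp only [φ]
    rw [this]; abel
  have hφy : ∀ s t : ℝ, φ (y + (s • b 0 + t • b 1)) = (s, t) := by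
    intro s t
    simp [φ]
  have hcount := grid_count (hK.image hφ) (hc.image φ hφ.continuousOn)
  have e0 : {q : ℤ × ℤ | y + ((q.1 : ℝ) • b 0 + (q.2 : ℝ) • b 1) ∈ K} = vtS (φ '' K) := by
    ext q
    constructor
    · intro h
      exact ⟨_, ⟨_, h, rfl⟩, by simp [hφy], by simp [hφy]⟩
    · rintro ⟨_, ⟨k, hk, rfl⟩, h1, h2⟩
      rw [mem_ofPred_eq, ← h1, ← h2, ← hrec]; exact hk
  have e1 : {q : ℤ × ℤ | y + ((q.1 : ℝ) • b 0 + (q.2 : ℝ) • b 1) ∈ K + segP (b 0)} =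
      heS (φ '' K) := by
    ext q
    constructor
    · rintro ⟨k, hk, _, ⟨s, hs, rfl⟩, h⟩
      have hk' : k = y + (((q.1 : ℝ) - s) • b 0 + (q.2 : ℝ) • b 1) := by
        rw [← sub_eq_iff_eq_add.2 h.symm]; module
      have hp := hφy ((q.1 : ℝ) - s) q.2
      rw [← hk'] at hp
      refine ⟨_, ⟨k, hk, rfl⟩, ?_, ?_, ?_⟩ <;> rw [hp] <;> simp only <;> linarith [hs.1, hs.2]
    · rintro ⟨_, ⟨k, hk, rfl⟩, h1, h2, h3⟩
      refine ⟨k, hk, _, ⟨(q.1 : ℝ) - (φ k).1, ⟨by linarith, by linarith⟩, rfl⟩, ?_⟩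
      simp only
      have := hrec k
      rw [h3] at this
      nth_rewrite 1 [this]
      module
  have e2 : {q : ℤ × ℤ | y + ((q.1 : ℝ) • b 0 + (q.2 : ℝ) • b 1) ∈ K + segP (b 1)} =
      veS (φ '' K) := by
    ext q
    constructor
    · rintro ⟨k, hk, _, ⟨s, hs, rfl⟩, h⟩
      have hk' : k = y + ((q.1 : ℝ) • b 0 + ((q.2 : ℝ) - s) • b 1) := by
        rw [← sub_eq_iff_eq_add.2 h.symm]; module
      have hp := hφy (q.1 : ℝ) (q.2 - s)
      rw [← hk'] at hp
      refine ⟨_, ⟨k, hk, rfl⟩, ?_, ?_, ?_⟩ <;> rw [hp] <;> simp only <;> linarith [hs.1, hs.2]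
    · rintro ⟨_, ⟨k, hk, rfl⟩, h1, h2, h3⟩
      refine ⟨k, hk, _, ⟨(q.2 : ℝ) - (φ k).2, ⟨by linarith, by linarith⟩, rfl⟩, ?_⟩
      simp only
      have := hrec k
      rw [h1] at this
      nth_rewrite 1 [this]
      module
  have e3 : {q : ℤ × ℤ | y + ((q.1 : ℝ) • b 0 + (q.2 : ℝ) • b 1) ∈
      K + segP (b 0) + segP (b 1)} = fcS (φ '' K) := by
    ext q
    constructor
    · rintro ⟨_, ⟨k, hk, _, ⟨s, hs, rfl⟩, rfl⟩, _, ⟨t, ht, rfl⟩, h⟩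
      have hk' : k = y + (((q.1 : ℝ) - s) • b 0 + ((q.2 : ℝ) - t) • b 1) := by
        simp only at h
        have : k = (k + s • b 0 + t • b 1) - s • b 0 - t • b 1 := by abel
        rw [this, h]; module
      have hp := hφy ((q.1 : ℝ) - s) (q.2 - t)
      rw [← hk'] at hp
      refine ⟨_, ⟨k, hk, rfl⟩, ?_, ?_, ?_, ?_⟩ <;> rw [hp] <;> simp only <;>
        linarith [hs.1, hs.2, ht.1, ht.2]
    · rintro ⟨_, ⟨k, hk, rfl⟩, h1, h2, h3, h4⟩
      refine ⟨_, ⟨k, hk, _, ⟨(q.1 : ℝ) - (φ k).1, ⟨by linarith, by linarith⟩, rfl⟩, rfl⟩,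
        _, ⟨(q.2 : ℝ) - (φ k).2, ⟨by linarith, by linarith⟩, rfl⟩, ?_⟩
      simp only
      conv_lhs => rw [hrec k]
      simp only [hφy]
      module
  simp only [cntP_eq, e0, e1, e2, e3]
  exact_mod_cast hcount


lemma vr_le_aux {A X Y K : Set Plane} (hX : IsCompact X) (hY : IsCompact Y) (hA : IsCompact A)
    (hK : IsCompact K) (hKY : K ⊆ Y)
    (h : volume (A \ X) ≤ volume (Y \ K)) :
    volume.real A + volume.real K ≤ volume.real X + volume.real Y := by
  have h1 : volume.real A ≤ volume.real X + volume.real (A \ X) := by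
    refine (measureReal_mono (s₂ := X ∪ (A \ X)) (by simp) ?_).trans (measureReal_union_le _ _)
    exact (measure_mono (t := X ∪ A) (by simp [sdiff_subset])).trans_lt
      (hX.union hA).measure_lt_top |>.ne
  have hYf : volume (Y \ K) ≠ ⊤ := ((measure_mono sdiff_subset).trans_lt hY.measure_lt_top).ne
  have h2 : volume.real (A \ X) ≤ volume.real (Y \ K) := ENNReal.toReal_mono hYf h
  have h3 : volume.real (Y \ K) = volume.real Y - volume.real K :=
    measureReal_sdiff hKY hK.measurableSet hY.measure_lt_top.ne
  linarith

lemma sub_add_segP (K : Set Plane) (u : Plane) : K ⊆ K + segP u := fun k hk =>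
  ⟨k, hk, 0, ⟨0, ⟨le_rfl, zero_le_one⟩, by simp⟩, by simp⟩

lemma second_diff_par (u : Plane) (c : ℝ) {K : Set Plane} (hK : IsCompact K) :
    volume.real (K + segP u + segP (c • u)) + volume.real K ≤
      volume.real (K + segP u) + volume.real (K + segP (c • u)) := by
  refine vr_le_aux (hK.add (segP_compact _)) (hK.add (segP_compact _))
    ((hK.add (segP_compact _)).add (segP_compact _)) hK (sub_add_segP _ _) ?_
  rcases le_or_gt 0 c with hc | hc
  · rw [← measure_preimage_add_right volume u]
    refine measure_mono ?_
    rintro y ⟨⟨_, ⟨k, hk, _, ⟨s, hs, rfl⟩, rfl⟩, _, ⟨t, ht, rfl⟩, hy⟩, h⟩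
    simp only at h hy
    have hgt : 1 < s + t * c := by
      by_contra hn
      push Not at hn
      refine h ⟨k, hk, _, ⟨s + t * c, ⟨?_, hn⟩, rfl⟩, ?_⟩
      · nlinarith [hs.1, hs.2, ht.1, ht.2]
      · simp only; rw [← hy]; module
    have hc' : 0 < c := by
      rcases hc.eq_or_lt with h0 | h0
      · subst h0; linarith [hs.2]
      · exact h0
    refine ⟨⟨k, hk, _, ⟨t + (s - 1) / c, ⟨?_, ?_⟩, rfl⟩, ?_⟩, fun hy' => h ?_⟩
    · have : t + (s - 1) / c = (s + t * c - 1) / c := by field_simp; ring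
      rw [this]; exact div_nonneg (by linarith) hc
    · have := div_nonpos_of_nonpos_of_nonneg (by linarith [hs.2] : s - 1 ≤ 0) hc
      linarith [ht.2]
    · simp only [smul_smul, add_mul, div_mul_cancel₀ _ hc'.ne']
      rw [eq_sub_of_add_eq hy.symm]; module
    · exact ⟨_, hy', u, ⟨1, by simp, by simp⟩, by simp⟩
  · refine measure_mono ?_
    rintro y ⟨⟨_, ⟨k, hk, _, ⟨s, hs, rfl⟩, rfl⟩, _, ⟨t, ht, rfl⟩, rfl⟩, h⟩
    simp only at h ⊢
    have hlt : s + t * c < 0 := by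
      by_contra hn
      push Not at hn
      refine h ⟨k, hk, _, ⟨s + t * c, ⟨hn, ?_⟩, rfl⟩, ?_⟩
      · nlinarith [hs.1, hs.2, ht.1, ht.2]
      · simp only; module
    refine ⟨⟨k, hk, _, ⟨t + s / c, ⟨?_, ?_⟩, rfl⟩, ?_⟩, fun hy => h (sub_add_segP _ _ hy)⟩
    · have : t + s / c = (s + t * c) / c := by
        rw [add_div, mul_div_cancel_right₀ _ hc.ne]; ring
      rw [this]; exact (div_pos_of_neg_of_neg hlt hc).le
    · have := div_nonpos_of_nonneg_of_nonpos hs.1 hc.le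
      linarith [ht.2]
    · simp only [smul_smul, add_mul, div_mul_cancel₀ _ hc.ne]; module

def PP (A B : Set Plane) (c : ℝ) : Prop := ∀ K : Set Plane, IsCompact K → IsConnected K →
  volume.real (K + A + B) + volume.real K ≤ volume.real (K + A) + volume.real (K + B) + c

lemma PP_symm {A B : Set Plane} {c : ℝ} (h : PP A B c) : PP B A c := by
  intro K hK hc
  have := h K hK hc
  rw [add_right_comm]
  linarith

lemma PP_add {A B B' : Set Plane} {c c' : ℝ} (hB : IsCompact B) (hBc : IsConnected B)
    (h : PP A B c) (h' : PP A B' c') : PP A (B + B') (c + c') := by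
  intro K hK hc
  have h1 := h K hK hc
  have h2 := h' (K + B) (hK.add hB) (conn_add hc hBc)
  rw [add_right_comm K B A] at h2
  rw [← add_assoc, ← add_assoc K B B']
  linarith

lemma PP_zero (A : Set Plane) : PP A 0 0 := by
  intro K hK hc
  simp

lemma PP_seg (u v : Plane) : ∃ c, PP (segP u) (segP v) c := by
  by_cases hu : u = 0
  · subst hu
    have : segP 0 = 0 := by
      ext x; simp [segP, eq_comm]
    rw [this]
    exact ⟨0, PP_symm (PP_zero _)⟩
  by_cases hli : LinearIndependent ℝ ![u, v]
  · let b := basisOfLinearIndependentOfCardEqFinrank hli (by simp)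
    have hb0 : b 0 = u := by simp [b]
    have hb1 : b 1 = v := by simp [b]
    refine ⟨volume.real (ZSpan.fundamentalDomain b), fun K hK hc => ?_⟩
    have h := second_diff_basis b hK hc
    rw [hb0, hb1] at h
    have f0 := hK.measure_lt_top (μ := volume) |>.ne
    have f1 := (hK.add (segP_compact u)).measure_lt_top (μ := volume) |>.ne
    have f2 := (hK.add (segP_compact v)).measure_lt_top (μ := volume) |>.ne
    have f3 := ((hK.add (segP_compact u)).add (segP_compact v)).measure_lt_top (μ := volume) |>.ne
    have f4 := (ZSpan.fundamentalDomain_isBounded b).measure_lt_top (μ := volume) |>.ne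
    have := ENNReal.toReal_mono (by finiteness) h
    rwa [ENNReal.toReal_add f3 f0, ENNReal.toReal_add (by finiteness) f4,
      ENNReal.toReal_add f1 f2] at this
  · rw [LinearIndependent.pair_iff' hu] at hli
    push Not at hli
    obtain ⟨c, rfl⟩ := hli
    exact ⟨0, fun K hK _ => by simpa using second_diff_par u c hK⟩

noncomputable def zonoP (l : List Plane) : Set Plane := (l.map segP).sum

lemma zonoP_cons (u : Plane) (l : List Plane) : zonoP (u :: l) = segP u + zonoP l := by
  simp [zonoP]

lemma zonoP_nil : zonoP [] = 0 := rfl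

lemma zonoP_compact (l : List Plane) : IsCompact (zonoP l) := by
  induction l with
  | nil => exact isCompact_singleton
  | cons u l ih => rw [zonoP_cons]; exact (segP_compact u).add ih

lemma zonoP_connected (l : List Plane) : IsConnected (zonoP l) := by
  induction l with
  | nil => exact isConnected_singleton
  | cons u l ih => rw [zonoP_cons]; exact conn_add (segP_connected u) ih

lemma segP_convex (u : Plane) : Convex ℝ (segP u) := by
  exact (convex_Icc (0:ℝ) 1).linear_image (LinearMap.toSpanSingleton ℝ Plane u)

lemma zonoP_convex (l : List Plane) : Convex ℝ (zonoP l) := by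
  induction l with
  | nil => exact convex_singleton _
  | cons u l ih => rw [zonoP_cons]; exact (segP_convex u).add ih

lemma PP_seg_zono (u : Plane) (l : List Plane) : ∃ c, PP (segP u) (zonoP l) c := by
  induction l with
  | nil => exact ⟨0, PP_zero _⟩
  | cons v l ih =>
    obtain ⟨c, hc⟩ := ih
    obtain ⟨c', hc'⟩ := PP_seg u v
    rw [zonoP_cons]
    exact ⟨_, PP_add (segP_compact v) (segP_connected v) hc' hc⟩

lemma PP_zono (l l' : List Plane) : ∃ c, PP (zonoP l) (zonoP l') c := by
  induction l with
  | nil => exact ⟨0, PP_symm (PP_zero _)⟩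
  | cons v l ih =>
    obtain ⟨c, hc⟩ := ih
    obtain ⟨c', hc'⟩ := PP_seg_zono v l'
    rw [zonoP_cons]
    exact ⟨_, PP_symm (PP_add (segP_compact v) (segP_connected v) (PP_symm hc') (PP_symm hc))⟩

lemma vr_smul {δ : ℝ} (hδ : 0 < δ) (A : Set Plane) :
    volume.real (δ • A) = δ ^ 2 * volume.real A := by
  rw [measureReal_def, Measure.addHaar_smul, ENNReal.toReal_mul, ENNReal.toReal_ofReal (by positivity)]
  simp [measureReal_def]

lemma PP_smul {A B : Set Plane} {c δ : ℝ} (hδ : 0 < δ) (h : PP A B c) :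
    PP (δ • A) (δ • B) (δ ^ 2 * c) := by
  intro K hK hc
  have hK' : K = δ • (δ⁻¹ • K) := by rw [smul_smul, mul_inv_cancel₀ hδ.ne', one_smul]
  have := h (δ⁻¹ • K) (hK.smul _) (hc.image _ (by fun_prop))
  rw [hK', ← smul_add, ← smul_add, ← smul_add, vr_smul hδ, vr_smul hδ, vr_smul hδ, vr_smul hδ]
  nlinarith [sq_nonneg δ]

lemma PP_iter {Z : Set Plane} {c : ℝ} (hc0 : 0 ≤ c) (hZ : IsCompact Z) (hZc : IsConnected Z)
    (h : PP Z Z c)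
    {K : Set Plane} (hK : IsCompact K) (hKc : IsConnected K) (m : ℕ) :
    volume.real (K + m • Z) - volume.real K ≤
      m * (volume.real (K + Z) - volume.real K) + m ^ 2 * c := by
  have hcc : ∀ j : ℕ, IsCompact (K + j • Z) ∧ IsConnected (K + j • Z) := by
    intro j
    induction j with
    | zero => simpa using ⟨hK, hKc⟩
    | succ j ih =>
      rw [succ_nsmul, ← add_assoc]
      exact ⟨ih.1.add hZ, conn_add ih.2 hZc⟩
  have hd : ∀ j : ℕ, volume.real (K + (j + 1) • Z) - volume.real (K + j • Z) ≤
      (volume.real (K + Z) - volume.real K) + j * c := by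
    intro j
    induction j with
    | zero => simp
    | succ j ih =>
      have := h _ (hcc j).1 (hcc j).2
      rw [add_assoc K, ← succ_nsmul, add_assoc K, ← succ_nsmul] at this
      push_cast
      linarith
  induction m with
  | zero => simp
  | succ m ih =>
    have := hd m
    push_cast
    have hm : (0:ℝ) ≤ m := Nat.cast_nonneg m
    nlinarith [mul_nonneg hm hc0]

noncomputable def hsup (l : List Plane) (x : Plane) : ℝ := (l.map (fun u => max 0 (inner ℝ u x))).sum

lemma hsup_le (l : List Plane) (x : Plane) : ∀ z ∈ zonoP l, inner ℝ z x ≤ hsup l x := by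
  induction l with
  | nil => intro z hz; have : z = 0 := hz; simp [this, hsup]
  | cons u l ih =>
    intro z hz
    rw [zonoP_cons] at hz
    obtain ⟨_, ⟨t, ht, rfl⟩, w, hw, rfl⟩ := hz
    have := ih w hw
    simp only [hsup, List.map_cons, List.sum_cons] at *
    rw [inner_add_left, real_inner_smul_left]
    refine add_le_add ?_ this
    rcases le_total 0 (inner ℝ u x) with h | h
    · exact (mul_le_of_le_one_left h ht.2).trans (le_max_right _ _)
    · exact (mul_nonpos_of_nonneg_of_nonpos ht.1 h).trans (le_max_left _ _)

lemma hsup_attained (l : List Plane) (x : Plane) : ∃ z ∈ zonoP l, inner ℝ z x = hsup l x := by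
  induction l with
  | nil => exact ⟨0, rfl, by simp [hsup]⟩
  | cons u l ih =>
    obtain ⟨w, hw, hwx⟩ := ih
    rw [zonoP_cons]
    simp only [hsup, List.map_cons, List.sum_cons] at *
    rcases le_total 0 (inner ℝ u x) with h | h
    · exact ⟨_, ⟨u, ⟨1, by simp, by simp⟩, w, hw, rfl⟩, by simp [inner_add_left, hwx, h]⟩
    · exact ⟨_, ⟨0, ⟨0, by simp, by simp⟩, w, hw, rfl⟩, by simp [hwx, h]⟩

lemma zonoP_ball (l : List Plane) (R : ℝ) (h1 : ∀ x, ‖x‖ ≤ hsup l x)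
    (h2 : ∀ x, hsup l x ≤ R * ‖x‖) :
    closedBall 0 1 ⊆ zonoP l ∧ zonoP l ⊆ closedBall 0 R := by
  constructor
  · intro x hx
    by_contra hxz
    obtain ⟨f, s, hf, hs⟩ := geometric_hahn_banach_closed_point (zonoP_convex l)
      (zonoP_compact l).isClosed hxz
    let w := (InnerProductSpace.toDual ℝ Plane).symm f
    have hw : ∀ y, f y = inner ℝ w y := fun y =>
      (InnerProductSpace.toDual_symm_apply (𝕜 := ℝ)).symm
    obtain ⟨z, hz, hzw⟩ := hsup_attained l w
    have a1 := hf z hz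
    rw [hw, real_inner_comm, hzw] at a1
    rw [hw] at hs
    have a2 := real_inner_le_norm w x
    have a3 : ‖x‖ ≤ 1 := by simpa using hx
    have a4 := h1 w
    have a5 := mul_le_of_le_one_right (norm_nonneg w) a3
    linarith
  · intro z hz
    have a1 := (hsup_le l z z hz).trans (h2 z)
    rw [real_inner_self_eq_norm_sq] at a1
    rw [mem_closedBall, dist_zero_right]
    by_contra hlt
    push Not at hlt
    rcases (norm_nonneg z).eq_or_lt with h | h
    · -- z = 0
      have b1 := h1 (EuclideanSpace.single (0 : Fin 2) (1 : ℝ))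
      have b2 := h2 (EuclideanSpace.single (0 : Fin 2) (1 : ℝ))
      simp at b1 b2
      linarith
    · nlinarith

noncomputable def dirP (θ : ℝ) : Plane := !₂[Real.cos θ, Real.sin θ]

lemma dirP_inner (a b : ℝ) : inner ℝ (dirP a) (dirP b) = Real.cos (a - b) := by
  simp [dirP, PiLp.inner_apply, Fin.sum_univ_two, Real.cos_sub]
  ring

lemma exists_polar (x : Plane) : ∃ α, x = ‖x‖ • dirP α := by
  let z : ℂ := ⟨x 0, x 1⟩
  have hn : ‖x‖ = ‖z‖ := by
    rw [EuclideanSpace.norm_eq, Complex.norm_eq_sqrt_sq_add_sq]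
    simp [Fin.sum_univ_two, z]
  refine ⟨z.arg, ?_⟩
  ext i
  rw [hn]
  fin_cases i
  · simp [dirP, Complex.norm_mul_cos_arg, z]
  · simp [dirP, Complex.norm_mul_sin_arg, z]

noncomputable def gP (x : ℝ) : ℝ := |Real.cos x| + |Real.sin x|

lemma gP_lip (x y : ℝ) : |gP x - gP y| ≤ 2 * |x - y| := by
  have h1 : |Real.cos x - Real.cos y| ≤ |x - y| := by
    simpa [Real.dist_eq] using Real.lipschitzWith_cos.dist_le_mul x y
  have h2 : |Real.sin x - Real.sin y| ≤ |x - y| := by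
    simpa [Real.dist_eq] using Real.lipschitzWith_sin.dist_le_mul x y
  have h3 := abs_abs_sub_abs_le_abs_sub (Real.cos x) (Real.cos y)
  have h4 := abs_abs_sub_abs_le_abs_sub (Real.sin x) (Real.sin y)
  unfold gP
  have h3' := abs_le.1 h3
  have h4' := abs_le.1 h4
  rw [abs_le]
  constructor <;> linarith [h3'.1, h3'.2, h4'.1, h4'.2]

lemma gP_per (x : ℝ) : gP (x + Real.pi / 2) = gP x := by
  simp [gP, Real.cos_add_pi_div_two, Real.sin_add_pi_div_two, add_comm]

lemma gP_ge (x : ℝ) : 1 ≤ gP x := by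
  unfold gP
  nlinarith [Real.sin_sq_add_cos_sq x, sq_abs (Real.sin x), sq_abs (Real.cos x),
    abs_nonneg (Real.sin x), abs_nonneg (Real.cos x)]

noncomputable def HP (M : ℕ) (β : ℝ) : ℝ :=
  ∑ r ∈ Finset.range M, gP (r * (Real.pi / 2 / M) + β)

lemma HP_near (M : ℕ) (hM : 0 < M) (β : ℝ) : |HP M β - HP M 0| ≤ Real.pi := by
  have hM' : (0:ℝ) < M := by exact_mod_cast hM
  have hper : Function.Periodic (HP M) (Real.pi / 2 / M) := by
    intro β
    have e1 : HP M (β + Real.pi / 2 / M) =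
        ∑ r ∈ Finset.range M, gP (((r + 1 : ℕ) : ℝ) * (Real.pi / 2 / M) + β) := by
      refine Finset.sum_congr rfl fun r _ => ?_
      congr 1; push_cast; ring
    have e2 := Finset.sum_range_succ (fun r : ℕ => gP ((r : ℝ) * (Real.pi / 2 / M) + β)) M
    have e3 := Finset.sum_range_succ' (fun r : ℕ => gP ((r : ℝ) * (Real.pi / 2 / M) + β)) M
    have e4 : gP ((M : ℝ) * (Real.pi / 2 / M) + β) = gP (((0 : ℕ) : ℝ) * (Real.pi / 2 / M) + β) := by
      rw [mul_div_cancel₀ _ hM'.ne', add_comm, gP_per]; simp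
    rw [e1]
    unfold HP
    linarith
  obtain ⟨y, hy, hyβ⟩ := hper.exists_mem_Ico₀ (by positivity) β
  rw [hyβ]
  unfold HP
  rw [← Finset.sum_sub_distrib]
  calc _ ≤ ∑ r ∈ Finset.range M, |gP (r * (Real.pi / 2 / M) + y) - gP (r * (Real.pi / 2 / M) + 0)| :=
        Finset.abs_sum_le_sum_abs _ _
    _ ≤ ∑ r ∈ Finset.range M, Real.pi / M := by
        refine Finset.sum_le_sum fun r _ => (gP_lip _ _).trans ?_
        have : (r * (Real.pi / 2 / M) + y) - (r * (Real.pi / 2 / M) + 0) = y := by ring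
        rw [this, abs_of_nonneg hy.1]
        have := hy.2
        have e : Real.pi / M = 2 * (Real.pi / 2 / M) := by ring
        linarith
    _ = Real.pi := by
        simp; field_simp

lemma HP_ge (M : ℕ) (β : ℝ) : M ≤ HP M β := by
  unfold HP
  calc (M : ℝ) = ∑ r ∈ Finset.range M, (1 : ℝ) := by simp
    _ ≤ _ := Finset.sum_le_sum fun r _ => gP_ge _

noncomputable def listP (ρ : ℝ) (M : ℕ) : List Plane :=
  (List.range M).flatMap fun r : ℕ => [ρ • dirP (r * (Real.pi / 2 / M)),
    ρ • dirP (r * (Real.pi / 2 / M) + Real.pi / 2), ρ • dirP (r * (Real.pi / 2 / M) + Real.pi),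
    ρ • dirP (r * (Real.pi / 2 / M) - Real.pi / 2)]

lemma hsup_append (l l' : List Plane) (x : Plane) : hsup (l ++ l') x = hsup l x + hsup l' x := by
  simp [hsup]

lemma four_max (θ : ℝ) : max 0 (Real.cos θ) + (max 0 (Real.cos (θ + Real.pi / 2)) +
    (max 0 (Real.cos (θ + Real.pi)) + max 0 (Real.cos (θ - Real.pi / 2)))) = gP θ := by
  rw [Real.cos_add_pi_div_two, Real.cos_add_pi, Real.cos_sub_pi_div_two, gP]
  rcases le_total 0 (Real.cos θ) with h | h <;> rcases le_total 0 (Real.sin θ) with h' | h' <;>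
    simp [h, h', abs_of_nonneg, abs_of_nonpos] <;> ring

lemma hsup_listP (ρ : ℝ) (hρ : 0 ≤ ρ) (M : ℕ) (x : Plane) (α : ℝ) (hx : x = ‖x‖ • dirP α) :
    hsup (listP ρ M) x = ρ * ‖x‖ * HP M (-α) := by
  have hin : ∀ θ, max 0 (inner ℝ (ρ • dirP θ) x) = ρ * ‖x‖ * max 0 (Real.cos (θ - α)) := by
    intro θ
    nth_rewrite 1 [hx]
    rw [real_inner_smul_left, real_inner_smul_right, dirP_inner, ← mul_assoc,
      mul_max_of_nonneg _ _ (by positivity), mul_zero]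
  have key : ∀ (f : ℕ → ℝ) (N : ℕ), hsup ((List.range N).flatMap fun r => [ρ • dirP (f r),
    ρ • dirP (f r + Real.pi / 2), ρ • dirP (f r + Real.pi),
    ρ • dirP (f r - Real.pi / 2)]) x = ρ * ‖x‖ * ∑ r ∈ Finset.range N, gP (f r - α) := by
    intro f N
    induction N with
    | zero => simp [hsup]
    | succ N ih =>
      rw [List.range_succ, List.flatMap_append, hsup_append, ih, Finset.sum_range_succ, mul_add]
      congr 1
      simp only [List.flatMap_cons, List.flatMap_nil, List.append_nil, hsup, List.map_cons,
        List.map_nil, List.sum_cons, List.sum_nil, add_zero, hin]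
      rw [← four_max, add_sub_right_comm, add_sub_right_comm, sub_right_comm]
      ring
  rw [listP, key (fun r : ℕ => (r : ℝ) * (Real.pi / 2 / M)), HP]
  rfl

lemma exists_zono {η : ℝ} (hη : 0 < η) : ∃ l : List Plane,
    closedBall 0 1 ⊆ zonoP l ∧ zonoP l ⊆ closedBall 0 (1 + η) := by
  obtain ⟨M, hM⟩ := exists_nat_gt ((2 * Real.pi + η * Real.pi) / η)
  have hpi := Real.pi_pos
  have hM0 : (0 : ℝ) < M := lt_trans (by positivity) hM
  rw [div_lt_iff₀ hη] at hM
  have hH := HP_ge M 0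
  have hbig : (2 * Real.pi + η * Real.pi) < HP M 0 * η :=
    hM.trans_le (mul_le_mul_of_nonneg_right hH hη.le)
  have hpos : 0 < HP M 0 - Real.pi := by
    by_contra hn
    push Not at hn
    nlinarith
  refine ⟨listP (HP M 0 - Real.pi)⁻¹ M, zonoP_ball _ _ ?_ ?_⟩
  · intro x
    obtain ⟨α, hα⟩ := exists_polar x
    rw [hsup_listP _ (by positivity) M x α hα]
    have := abs_le.1 (HP_near M (by exact_mod_cast hM0) (-α))
    have h1 : 1 ≤ (HP M 0 - Real.pi)⁻¹ * HP M (-α) := by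
      rw [inv_mul_eq_div, le_div_iff₀ hpos]; linarith [this.1]
    nlinarith [norm_nonneg x]
  · intro x
    obtain ⟨α, hα⟩ := exists_polar x
    rw [hsup_listP _ (by positivity) M x α hα]
    have := abs_le.1 (HP_near M (by exact_mod_cast hM0) (-α))
    have h1 : (HP M 0 - Real.pi)⁻¹ * HP M (-α) ≤ 1 + η := by
      rw [inv_mul_eq_div, div_le_iff₀ hpos]; linarith [this.2]
    nlinarith [norm_nonneg x]

lemma main_bound {η : ℝ} (hη : 0 < η) : ∃ C : ℝ, 0 ≤ C ∧ ∀ K : Set Plane, IsCompact K →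
    IsConnected K → ∀ ε : ℝ, 0 < ε → ∀ s : ℝ, 0 ≤ s → SM1 K < ENNReal.ofReal s →
    volume.real (cthickening ε K) - volume.real K ≤ ε * ((1 + η) * s + C * ε) := by
  obtain ⟨l, hl1, hl2⟩ := exists_zono hη
  obtain ⟨c, hc⟩ := PP_zono l l
  set Z := zonoP l with hZ
  have hc' : PP Z Z (max c 0) := fun K hK hKc => (hc K hK hKc).trans (by gcongr; exact le_max_left _ _)
  refine ⟨max c 0, le_max_right _ _, ?_⟩
  intro K hK hKc ε hε s hs0 hs
  have hev := eventually_lt_of_limsup_lt hs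
  rw [eventually_nhdsWithin_iff, Metric.eventually_nhds_iff] at hev
  obtain ⟨δ₀, hδ₀, hev⟩ := hev
  obtain ⟨m, hm⟩ := exists_nat_gt ((1 + η) * ε / δ₀)
  have hm0 : (0 : ℝ) < m := lt_trans (by positivity) hm
  set δ := ε / m with hδ
  have hδpos : 0 < δ := by positivity
  have hmδ : m * δ = ε := by rw [hδ]; field_simp
  have hδ' : (1 + η) * δ < δ₀ := by
    rw [div_lt_iff₀ hδ₀] at hm
    rw [hδ, ← mul_div_assoc, div_lt_iff₀ hm0]; linarith
  have hδ'pos : 0 < (1 + η) * δ := by positivity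
  have h1 := hev (y := (1 + η) * δ) (by rw [Real.dist_eq, sub_zero, abs_of_pos hδ'pos]; exact hδ')
    hδ'pos
  have hcomp : IsCompact (cthickening ((1 + η) * δ) K) := hK.cthickening
  have h2 : volume.real (cthickening ((1 + η) * δ) K) - volume.real K ≤ s * ((1 + η) * δ) := by
    rw [← measureReal_sdiff (self_subset_cthickening K) hK.measurableSet hcomp.measure_lt_top.ne]
    have h3 := (ENNReal.div_le_iff (by simpa using hδ'pos) (by simp)).1 h1.le
    rw [← ENNReal.ofReal_mul hs0] at h3
    exact ENNReal.toReal_le_of_le_ofReal (by positivity) h3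
  have hsub1 : K + δ • Z ⊆ cthickening ((1 + η) * δ) K := by
    rintro _ ⟨k, hk, _, ⟨z, hz, rfl⟩, rfl⟩
    refine mem_cthickening_of_dist_le _ k _ _ hk ?_
    have := hl2 hz
    rw [mem_closedBall, dist_zero_right] at this
    simp only [dist_self_add_left, norm_smul, Real.norm_eq_abs, abs_of_pos hδpos]
    nlinarith
  have hZc : IsCompact (δ • Z) := (zonoP_compact l).smul δ
  have hZconn : IsConnected (δ • Z) := (zonoP_connected l).image _ (by fun_prop)
  have hsub2 : cthickening ε K ⊆ K + m • (δ • Z) := by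
    rw [hK.cthickening_eq_biUnion_closedBall hε.le]
    intro x hx
    simp only [mem_iUnion] at hx
    obtain ⟨k, hk, hxk⟩ := hx
    rw [mem_closedBall, dist_eq_norm] at hxk
    refine ⟨k, hk, x - k, ?_, by simp⟩
    have hz : ε⁻¹ • (x - k) ∈ Z := by
      apply hl1
      rw [mem_closedBall, dist_zero_right, norm_smul, norm_inv, Real.norm_eq_abs, abs_of_pos hε,
        inv_mul_le_iff₀ hε]
      linarith
    have : x - k = m • (δ • (ε⁻¹ • (x - k))) := by
      rw [← Nat.cast_smul_eq_nsmul ℝ, smul_smul, smul_smul, hmδ,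
        mul_inv_cancel₀ hε.ne', one_smul]
    rw [this]
    exact Set.nsmul_mem_nsmul (Set.smul_mem_smul_set hz)
  have hKm : volume (K + m • (δ • Z)) ≠ ⊤ := by
    have : ∀ j : ℕ, IsCompact (K + j • (δ • Z)) := by
      intro j
      induction j with
      | zero => simpa using hK
      | succ j ih => rw [succ_nsmul, ← add_assoc]; exact ih.add hZc
    exact (this m).measure_lt_top.ne
  have h3 := measureReal_mono (μ := volume) hsub2 hKm
  have h4 := PP_iter (by positivity) hZc hZconn (PP_smul hδpos hc') hK hKc m
  have h5 := measureReal_mono (μ := volume) hsub1 hcomp.measure_lt_top.ne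
  have h6 : (m : ℝ) * (volume.real (K + δ • Z) - volume.real K) ≤ m * (s * ((1 + η) * δ)) := by
    gcongr; linarith
  have e1 : (m : ℝ) * (s * ((1 + η) * δ)) = ε * ((1 + η) * s) := by rw [← hmδ]; ring
  have e2 : (m : ℝ) ^ 2 * (δ ^ 2 * max c 0) = ε * (max c 0 * ε) := by rw [← hmδ]; ring
  rw [e2] at h4
  rw [e1] at h6
  linarith

/-- Lower semicontinuity of the outer Minkowski content with respect to
Hausdorff convergence of continua contained in a fixed compact set. -/
theorem stmt_4 (C : Set Plane) (hC : IsCompact C)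
    (Kseq : ℕ → Set Plane) (hKseq : ∀ n, Kseq n ⊆ C)
    (hcpt : ∀ n, IsCompact (Kseq n)) (hconn : ∀ n, IsConnected (Kseq n))
    (K : Set Plane) (hK : IsCompact K) (hKconn : IsConnected K)
    (hconv : Tendsto (fun n => hausdorffDist (Kseq n) K) atTop (𝓝 0)) :
    SM1 K ≤ liminf (fun n => SM1 (Kseq n)) atTop := by
  refine le_of_forall_lt fun c hc => ?_
  obtain ⟨c₂, hcc₂, hc₂⟩ := ENNReal.lt_iff_exists_nnreal_btwn.1 hc
  obtain ⟨c', hc₂c', hc'⟩ := ENNReal.lt_iff_exists_nnreal_btwn.1 hc₂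
  refine hcc₂.trans_le ?_
  have hlt : (c₂ : ℝ) < c' := by exact_mod_cast hc₂c'
  -- choice of η
  obtain ⟨η, hη, hηc⟩ : ∃ η : ℝ, 0 < η ∧ (1 + η) ^ 2 * (c₂ : ℝ) + η < c' := by
    have hcont : Continuous fun η : ℝ => (1 + η) ^ 2 * (c₂ : ℝ) + η := by fun_prop
    have h0 : ∀ᶠ η in 𝓝 (0 : ℝ), (1 + η) ^ 2 * (c₂ : ℝ) + η < c' :=
      hcont.continuousAt.eventually_lt continuousAt_const (by simpa using hlt)
    have h1 : ∀ᶠ η in 𝓝[>] (0 : ℝ), (1 + η) ^ 2 * (c₂ : ℝ) + η < c' := h0.filter_mono nhdsWithin_le_nhds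
    obtain ⟨η, h, h'⟩ := (h1.and self_mem_nhdsWithin).exists
    exact ⟨η, h', h⟩
  obtain ⟨B, hB, hmain⟩ := main_bound hη
  -- choice of ε
  have hfreq := frequently_lt_of_lt_limsup (by isBoundedDefault) hc'
  have hsmall : ∀ᶠ ε in 𝓝[>] (0 : ℝ), (1 + η) ^ 2 * (c₂ : ℝ) + η + B * (1 + η) ^ 2 * ε < c' := by
    have hcont : Continuous fun ε : ℝ => (1 + η) ^ 2 * (c₂ : ℝ) + η + B * (1 + η) ^ 2 * ε := by
      fun_prop
    exact (hcont.continuousAt.eventually_lt continuousAt_const (by simpa using hηc)).filter_mono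
      nhdsWithin_le_nhds
  obtain ⟨ε, hεbig, hεsmall, hε⟩ :=
    (hfreq.and_eventually (hsmall.and self_mem_nhdsWithin)).exists
  have hε : 0 < ε := hε
  have hlow : c' * ε ≤ volume.real (cthickening ε K) - volume.real K := by
    have hcomp : IsCompact (cthickening ε K) := hK.cthickening
    rw [← measureReal_sdiff (self_subset_cthickening K) hK.measurableSet hcomp.measure_lt_top.ne]
    have hfin : volume (cthickening ε K \ K) ≠ ⊤ :=
      ((measure_mono sdiff_subset).trans_lt hcomp.measure_lt_top).ne
    have h3 := (ENNReal.le_div_iff_mul_le (Or.inl (by simpa using hε)) (Or.inl (by simp))).1 hεbig.le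
    have := ENNReal.toReal_mono hfin h3
    rwa [ENNReal.toReal_mul, ENNReal.toReal_ofReal hε.le] at this
  -- choice of r
  obtain ⟨r, hr0, hrη, hrvol⟩ : ∃ r : ℝ, 0 < r ∧ r ≤ η * ε ∧
      volume.real (cthickening r K) ≤ volume.real K + η * ε := by
    have ht := tendsto_measure_cthickening_of_isCompact (μ := volume) hK
    have ht' := (ENNReal.tendsto_toReal hK.measure_lt_top.ne).comp ht
    have h1 : ∀ᶠ r in 𝓝 (0 : ℝ), volume.real (cthickening r K) < volume.real K + η * ε :=
      ht'.eventually_lt_const (by simp only [measureReal_def]; linarith [mul_pos hη hε])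
    have h2 : ∀ᶠ r in 𝓝 (0 : ℝ), r < η * ε := eventually_lt_nhds (mul_pos hη hε)
    obtain ⟨r, ⟨h, h'⟩, h''⟩ :=
      (((h1.and h2).filter_mono nhdsWithin_le_nhds).and (self_mem_nhdsWithin (s := Ioi (0:ℝ)))).exists
    exact ⟨r, h'', h'.le, h.le⟩
  refine le_liminf_of_le (by isBoundedDefault) ?_
  filter_upwards [hconv.eventually_lt_const hr0] with n hn
  by_contra hcon
  push Not at hcon
  have hfin : hausdorffEDist (Kseq n) K ≠ ⊤ :=
    hausdorffEDist_ne_top_of_nonempty_of_bounded (hconn n).nonempty hKconn.nonempty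
      (hcpt n).isBounded hK.isBounded
  have hε1 : 0 < (1 + η) * ε := by positivity
  have hup := hmain (Kseq n) (hcpt n) (hconn n) ((1 + η) * ε) hε1 c₂ c₂.2
    (by rwa [ENNReal.ofReal_coe_nnreal])
  have s1 : Kseq n ⊆ cthickening r K := by
    intro x hx
    obtain ⟨y, hy, hxy⟩ := exists_dist_lt_of_hausdorffDist_lt hx hn hfin
    exact mem_cthickening_of_dist_le _ y _ _ hy hxy.le
  have s2 : cthickening ε K ⊆ cthickening ((1 + η) * ε) (Kseq n) := by
    rw [hK.cthickening_eq_biUnion_closedBall hε.le]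
    intro x hx
    simp only [mem_iUnion] at hx
    obtain ⟨k, hk, hxk⟩ := hx
    obtain ⟨y, hy, hky⟩ := exists_dist_lt_of_hausdorffDist_lt' hk hn hfin
    refine mem_cthickening_of_dist_le _ y _ _ hy ?_
    rw [mem_closedBall] at hxk
    have := dist_triangle x k y
    rw [dist_comm y k] at hky
    linarith
  have v1 := measureReal_mono (μ := volume) s1
    (hK.cthickening (r := r)).measure_lt_top.ne
  have v2 := measureReal_mono (μ := volume) s2
    ((hcpt n).cthickening (r := (1 + η) * ε)).measure_lt_top.ne
  have key : (c' : ℝ) * ε ≤ ((1 + η) ^ 2 * (c₂ : ℝ) + η + B * (1 + η) ^ 2 * ε) * ε := by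
    have e : (1 + η) * ε * ((1 + η) * (c₂ : ℝ) + B * ((1 + η) * ε)) + η * ε =
      ((1 + η) ^ 2 * (c₂ : ℝ) + η + B * (1 + η) ^ 2 * ε) * ε := by ring
    rw [← e]
    linarith
  have := le_of_mul_le_mul_right key hε
  linarith
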